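/- Win/lose-solvability of a two-person game form implies Nash-solvability: if g : X₁ × X₂ → A has a saddle point for every ±1 payoff on outcomes, then for arbitrary payoff functions u₁, u₂ : A → ℝ the game (g, u₁, u₂) has a pure Nash equilibrium. -/

import Mathlib

/-- `g` is Nash-solvable: every pair of payoffs on outcomes yields a game with
a pure Nash equilibrium. -/
def NashSolvable {X₁ X₂ A : Type*} (g : X₁ → X₂ → A) : Prop :=
  ∀ u₁ u₂ : A → ℝ, ∃ x₁s x₂s,
    (∀ x₁, u₁ (g x₁ x₂s) ≤ u₁ (g x₁s x₂s)) ∧ (∀ x₂, u₂ (g x₁s x₂) ≤ u₂ (g x₁s x₂s))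

/-- `g` is zero-sum-solvable: for every `u : A → ℝ` the zero-sum game `u ∘ g`
(player 1 maximizes, player 2 minimizes) has a saddle point. -/
def ZeroSumSolvable {X₁ X₂ A : Type*} (g : X₁ → X₂ → A) : Prop :=
  ∀ u : A → ℝ, ∃ x₁s x₂s,
    (∀ x₁, u (g x₁ x₂s) ≤ u (g x₁s x₂s)) ∧ (∀ x₂, u (g x₁s x₂s) ≤ u (g x₁s x₂))

/-- `g` is win/lose-solvable: zero-sum solvability restricted to `±1`-valued payoffs. -/
def WinLoseSolvable {X₁ X₂ A : Type*} (g : X₁ → X₂ → A) : Prop :=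
  ∀ u : A → ℝ, (∀ a, u a = 1 ∨ u a = -1) → ∃ x₁s x₂s,
    (∀ x₁, u (g x₁ x₂s) ≤ u (g x₁s x₂s)) ∧ (∀ x₂, u (g x₁s x₂s) ≤ u (g x₁s x₂))

/-- Win/lose-solvability says that for each set `S` of outcomes either player 1 can force `S`
or player 2 can force its complement. -/
theorem WinLoseSolvable.forces_or_forces_compl {X₁ X₂ A : Type*} {g : X₁ → X₂ → A}
    (h : WinLoseSolvable g) (S : Set A) :
    (∃ x₁, ∀ x₂, g x₁ x₂ ∈ S) ∨ (∃ x₂, ∀ x₁, g x₁ x₂ ∉ S) := by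
  classical
  obtain ⟨x₁, x₂, h₁, h₂⟩ := h (fun a => if a ∈ S then 1 else -1) (fun a => by
    by_cases ha : a ∈ S <;> simp [ha])
  by_cases hS : g x₁ x₂ ∈ S
  · refine Or.inl ⟨x₁, fun y => ?_⟩
    by_contra hy
    have := h₂ y
    norm_num [hS, hy] at this
  · refine Or.inr ⟨x₂, fun y hy => ?_⟩
    have := h₁ y
    norm_num [hS, hy] at this

/-- In a finite nonempty family of sets some member is lexicographically optimal for the payoff
`u`: below no threshold does another member meet strictly fewer outcomes. -/
theorem exists_forall_not_sublevel_ssubset {X A : Type*} [Finite X] [Nonempty X]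
    (R : X → Set A) (u : A → ℝ) :
    ∃ x, ∀ y t, ¬ R y ∩ {a | u a ≤ t} ⊂ R x ∩ {a | u a ≤ t} := by
  let r : X → X → Prop := fun y x => ∃ t, R y ∩ {a | u a ≤ t} ⊂ R x ∩ {a | u a ≤ t}
  have mono {y x : X} {s t : ℝ} (hst : s ≤ t)
      (hyx : R y ∩ {a | u a ≤ t} ⊆ R x ∩ {a | u a ≤ t}) :
      R y ∩ {a | u a ≤ s} ⊆ R x ∩ {a | u a ≤ s} :=
    fun a ha => ⟨(hyx ⟨ha.1, le_trans ha.2 hst⟩).1, ha.2⟩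
  have : IsTrans X r := ⟨by
    rintro z y x ⟨s, hs⟩ ⟨t, ht⟩
    rcases le_total s t with hst | hts
    · exact ⟨s, hs.trans_subset (mono hst ht.subset)⟩
    · exact ⟨t, (mono hts hs.subset).trans_ssubset ht⟩⟩
  have : Std.Irrefl r := ⟨fun x ⟨_, ht⟩ => ssubset_irrefl _ ht⟩
  obtain ⟨x, -, hx⟩ := (Finite.wellFounded_of_trans_of_irrefl r).has_min Set.univ Set.univ_nonempty
  exact ⟨x, fun y t hyx => hx y trivial ⟨t, hyx⟩⟩

/-- A win/lose-solvable two-person game form is Nash-solvable. -/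
theorem winlose_solvable_implies_nash {X₁ X₂ A : Type*}
    [Fintype X₁] [Fintype X₂] [Fintype A] [Nonempty X₁] [Nonempty X₂] [Nonempty A]
    (g : X₁ → X₂ → A) (h : WinLoseSolvable g) : NashSolvable g := by
  intro u₁ u₂
  obtain ⟨x₁, hx₁⟩ := exists_forall_not_sublevel_ssubset (fun x => Set.range (g x)) u₁
  obtain ⟨y, hy⟩ := Finite.exists_max fun x₂ => u₂ (g x₁ x₂)
  rcases h.forces_or_forces_compl
      {a | (a ∈ Set.range (g x₁) ∧ a ≠ g x₁ y) ∨ u₁ (g x₁ y) < u₁ a} with ⟨x, hx⟩ | ⟨x₂, hx₂⟩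
  · refine absurd ?_ (hx₁ x (u₁ (g x₁ y)))
    rw [Set.ssubset_iff_of_subset]
    · refine ⟨g x₁ y, ⟨⟨y, rfl⟩, le_refl (u₁ (g x₁ y))⟩, ?_⟩
      rintro ⟨⟨z, hz⟩, -⟩
      rcases hx z with hz' | hz'
      · exact hz'.2 hz
      · exact hz'.ne' (congrArg u₁ hz)
    · rintro _ ⟨⟨z, rfl⟩, hz⟩
      rcases hx z with hz' | hz'
      · exact ⟨hz'.1, hz⟩
      · exact absurd hz (not_le.mpr hz')
  · have heq : g x₁ x₂ = g x₁ y := by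
      by_contra hne
      exact hx₂ x₁ (Or.inl ⟨⟨x₂, rfl⟩, hne⟩)
    refine ⟨x₁, x₂, fun x => ?_, fun x => ?_⟩
    · rw [heq]
      exact not_lt.mp fun hlt => hx₂ x (Or.inr hlt)
    · rw [heq]
      exact hy x
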